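/- arXiv:1901.02234 — 2 statements merged into one kernel-verified Lean document; each statement's English description precedes it below -/
import Mathlib

section
/- For every complex s with Re(s) > 0, Φ_k(s) = (1/2πi) ∫_{2-i∞}^{2+i∞} ζ(z+1) ζ(kz) Γ(z) s^{-z} dz, where Φ_k(s) := ∑_{m≥1} -log(1 - e^{-m^k s}). -/
open Complex
open MeasureTheory Set Filter Topology

theorem norm_cpow_mul_exp_neg_mul {z s : ℂ} {x : ℝ} (hx : 0 < x) :
    ‖(x : ℂ) ^ (z - 1) * Complex.exp (-(s * x))‖ = x ^ (z.re - 1) * Real.exp (-s.re * x) := by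
  rw [norm_mul, norm_cpow_eq_rpow_re_of_pos hx, Complex.norm_exp]
  simp

theorem integrableOn_rpow_mul_exp_neg_mul_Ioi {a b : ℝ} (ha : 0 < a) (hb : 0 < b) :
    IntegrableOn (fun x : ℝ ↦ x ^ (a - 1) * Real.exp (-b * x)) (Ioi 0) := by
  simpa using integrableOn_rpow_mul_exp_neg_mul_rpow (by linarith : -1 < a - 1) one_pos hb

theorem continuousOn_cpow_mul_exp_neg_mul (z s : ℂ) :
    ContinuousOn (fun x : ℝ ↦ (x : ℂ) ^ (z - 1) * Complex.exp (-(s * x))) (Ioi 0) := by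
  refine ContinuousOn.mul (fun x hx ↦ ?_) (by fun_prop)
  exact (continuousAt_ofReal_cpow_const x _ (Or.inr (ne_of_gt hx))).continuousWithinAt

theorem integrableOn_cpow_mul_exp_neg_mul_Ioi {z s : ℂ} (hz : 0 < z.re) (hs : 0 < s.re) :
    IntegrableOn (fun x : ℝ ↦ (x : ℂ) ^ (z - 1) * Complex.exp (-(s * x))) (Ioi 0) := by
  refine (integrableOn_rpow_mul_exp_neg_mul_Ioi hz hs).mono'
    ((continuousOn_cpow_mul_exp_neg_mul z s).aestronglyMeasurable measurableSet_Ioi) ?_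
  filter_upwards [ae_restrict_mem measurableSet_Ioi] with x hx
  exact (norm_cpow_mul_exp_neg_mul hx).le

theorem differentiableAt_integral_cpow_mul_exp_neg_mul {z s : ℂ} (hz : 0 < z.re) (hs : 0 < s.re) :
    DifferentiableAt ℂ
      (fun w : ℂ ↦ ∫ x : ℝ in Ioi 0, (x : ℂ) ^ (z - 1) * Complex.exp (-(w * x))) s := by
  have hb : 0 < s.re / 2 := half_pos hs
  refine (hasDerivAt_integral_of_dominated_loc_of_deriv_le
    (F' := fun w x ↦ (x : ℂ) ^ (z - 1) * (Complex.exp (-(w * x)) * -x))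
    (bound := fun x ↦ x ^ (z.re + 1 - 1) * Real.exp (-(s.re / 2) * x))
    (Metric.ball_mem_nhds s hb) (Eventually.of_forall fun w ↦
      (continuousOn_cpow_mul_exp_neg_mul z w).aestronglyMeasurable measurableSet_Ioi)
    (integrableOn_cpow_mul_exp_neg_mul_Ioi hz hs) ?_ ?_
    (integrableOn_rpow_mul_exp_neg_mul_Ioi (by linarith) hb) ?_).2.differentiableAt
  · simp_rw [← mul_assoc]
    exact ((continuousOn_cpow_mul_exp_neg_mul z s).mul (by fun_prop)).aestronglyMeasurable
      measurableSet_Ioi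
  · filter_upwards [ae_restrict_mem measurableSet_Ioi] with x (hx : 0 < x) w hw
    have hre : s.re / 2 ≤ w.re := by
      have h1 := (abs_le.1 ((abs_re_le_norm (w - s)).trans (mem_ball_iff_norm.1 hw).le)).1
      rw [sub_re] at h1
      linarith
    rw [← mul_assoc, norm_mul, norm_cpow_mul_exp_neg_mul hx, norm_neg, norm_real,
      Real.norm_of_nonneg hx.le, mul_right_comm, add_sub_right_comm, Real.rpow_add_one hx.ne']
    gcongr
  · refine Eventually.of_forall fun x w _ ↦ HasDerivAt.const_mul _ (HasDerivAt.cexp ?_)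
    convert! ((hasDerivAt_id w).mul_const (x : ℂ)).neg using 1
    simp

theorem integral_cpow_mul_exp_neg_mul_Ioi_of_re_pos {z s : ℂ} (hz : 0 < z.re) (hs : 0 < s.re) :
    ∫ x : ℝ in Ioi 0, (x : ℂ) ^ (z - 1) * Complex.exp (-(s * x)) = s ^ (-z) * Complex.Gamma z := by
  have hopen : IsOpen {w : ℂ | 0 < w.re} := isOpen_lt continuous_const continuous_re
  have hconv : IsPreconnected {w : ℂ | 0 < w.re} :=
    (convex_halfSpace_re_gt 0).isPreconnected
  have hf : AnalyticOnNhd ℂ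
      (fun w : ℂ ↦ ∫ x : ℝ in Ioi 0, (x : ℂ) ^ (z - 1) * Complex.exp (-(w * x)))
      {w : ℂ | 0 < w.re} :=
    DifferentiableOn.analyticOnNhd (fun w hw ↦
      (differentiableAt_integral_cpow_mul_exp_neg_mul hz hw).differentiableWithinAt) hopen
  have hg : AnalyticOnNhd ℂ (fun w : ℂ ↦ w ^ (-z) * Complex.Gamma z) {w : ℂ | 0 < w.re} :=
    DifferentiableOn.analyticOnNhd (fun w hw ↦ ((differentiableAt_id.cpow_const
      (Or.inl hw)).mul_const _).differentiableWithinAt) hopen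
  have hreal : ∀ r : ℝ, 0 < r → ∫ x : ℝ in Ioi 0, (x : ℂ) ^ (z - 1) * Complex.exp (-(r * x)) =
      (r : ℂ) ^ (-z) * Complex.Gamma z := fun r hr ↦ by
    rw [Complex.integral_cpow_mul_exp_neg_mul_Ioi hz hr, one_div, inv_cpow, cpow_neg]
    rw [arg_ofReal_of_nonneg hr.le]
    exact Real.pi_pos.ne
  refine hf.eqOn_of_preconnected_of_frequently_eq hg hconv (z₀ := 1) (by simp) ?_ hs
  have ht : Tendsto (fun r : ℝ ↦ (r : ℂ)) (𝓝[>] 1) (𝓝[≠] 1) := by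
    refine tendsto_nhdsWithin_iff.2 ⟨?_, ?_⟩
    · exact (continuous_ofReal.tendsto' 1 1 (by simp)).mono_left nhdsWithin_le_nhds
    · filter_upwards [self_mem_nhdsWithin] with r hr
      simpa using (ne_of_gt hr : r ≠ 1)
  refine ht.frequently (Eventually.frequently ?_)
  filter_upwards [self_mem_nhdsWithin] with r hr
  exact hreal r (one_pos.trans hr)

theorem verticalIntegrable_Gamma_mul_cpow_neg {σ : ℝ} (hσ : 0 < σ) {s : ℂ} (hs : 0 < s.re) :
    VerticalIntegrable (fun z ↦ Complex.Gamma z * s ^ (-z)) σ := by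
  have hs0 : s ≠ 0 := by rintro rfl; simp at hs
  have hre (t : ℝ) : ((σ : ℂ) + t * I).re = σ := by simp
  have hne (t : ℝ) : (σ : ℂ) + t * I ≠ 0 := fun h ↦ hσ.ne' (by simpa using congrArg re h)
  have hne1 (t : ℝ) : (σ : ℂ) + t * I + 1 ≠ 0 := fun h ↦ by
    have : σ + 1 = 0 := by simpa using congrArg re h
    linarith
  set B : ℝ := ∫ x : ℝ in Ioi 0, x ^ (σ + 2 - 1) * Real.exp (-s.re * x)
  have hB : 0 ≤ B := setIntegral_nonneg measurableSet_Ioi fun x (hx : 0 < x) ↦ by positivity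
  have hbound (t : ℝ) :
      ‖Complex.Gamma (σ + t * I + 2) * s ^ (-((σ : ℂ) + t * I + 2))‖ ≤ B := by
    rw [mul_comm, ← integral_cpow_mul_exp_neg_mul_Ioi_of_re_pos (by simp; linarith) hs]
    refine (norm_integral_le_integral_norm _).trans_eq (setIntegral_congr_fun measurableSet_Ioi
      fun x hx ↦ ?_)
    simp only [norm_cpow_mul_exp_neg_mul (mem_Ioi.1 hx), add_re, hre, re_ofNat]
  have hint : Integrable (fun t : ℝ ↦ B * ‖s‖ ^ 2 * (σ ^ 2 + t ^ 2)⁻¹) := by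
    have h := (integrable_inv_one_add_sq.comp_div hσ.ne').const_mul (B * ‖s‖ ^ 2 * (σ ^ 2)⁻¹)
    refine h.congr (Eventually.of_forall fun t ↦ ?_)
    have : 0 < σ ^ 2 + t ^ 2 := by positivity
    simp only
    field_simp
  refine hint.mono' (Continuous.aestronglyMeasurable ?_) (Eventually.of_forall fun t ↦ ?_)
  · refine Continuous.mul (continuous_iff_continuousAt.2 fun t ↦ ?_) ?_
    · refine ContinuousAt.comp (f := fun t : ℝ ↦ (σ : ℂ) + t * I) (continuousAt_Gamma _ fun m h ↦ ?_)
        (by fun_prop)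
      have : σ = -m := by simpa using congrArg re h
      linarith [m.cast_nonneg (α := ℝ)]
    · exact Continuous.const_cpow (by fun_prop) (Or.inl hs0)
  · have hΓ : Complex.Gamma (σ + t * I) * s ^ (-((σ : ℂ) + t * I)) =
        Complex.Gamma (σ + t * I + 2) * s ^ (-((σ : ℂ) + t * I + 2)) * s ^ 2 /
          (((σ : ℂ) + t * I + 1) * (σ + t * I)) := by
      have h2 : (σ : ℂ) + t * I + 2 = σ + t * I + 1 + 1 := by ring
      have h3 : -((σ : ℂ) + t * I + 2) = -(σ + t * I) - (2 : ℕ) := by push_cast; ring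
      rw [h3, cpow_sub _ _ hs0, cpow_natCast, h2, Gamma_add_one _ (hne1 t), Gamma_add_one _ (hne t)]
      field_simp [hne t, hne1 t]
    have h1 : σ ^ 2 + t ^ 2 ≤ ‖(σ : ℂ) + t * I + 1‖ * ‖(σ : ℂ) + t * I‖ := by
      have e1 : ‖(σ : ℂ) + t * I‖ ^ 2 = σ ^ 2 + t ^ 2 := by
        rw [← normSq_eq_norm_sq, normSq_add_mul_I]
      have e2 : ‖(σ : ℂ) + t * I + 1‖ ^ 2 = (σ + 1) ^ 2 + t ^ 2 := by
        rw [← normSq_eq_norm_sq, ← normSq_add_mul_I]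
        push_cast
        ring_nf
      have h : ‖(σ : ℂ) + t * I‖ ≤ ‖(σ : ℂ) + t * I + 1‖ :=
        (sq_le_sq₀ (norm_nonneg _) (norm_nonneg _)).1 (by rw [e1, e2]; nlinarith)
      nlinarith [norm_nonneg ((σ : ℂ) + t * I)]
    simp only [hΓ]
    rw [norm_div, norm_mul, norm_mul (_ + 1), norm_pow, div_eq_mul_inv]
    gcongr
    exact hbound t

theorem integral_cpow_neg_mul_Gamma_mul_cpow_neg {σ : ℝ} (hσ : 0 < σ) {s : ℂ} (hs : 0 < s.re)
    {x : ℝ} (hx : 0 < x) :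
    ∫ t : ℝ, (x : ℂ) ^ (-((σ : ℂ) + t * I)) *
        (Complex.Gamma (σ + t * I) * s ^ (-((σ : ℂ) + t * I))) =
      2 * Real.pi * Complex.exp (-(s * x)) := by
  have hm (t : ℝ) : mellin (fun x : ℝ ↦ Complex.exp (-(s * x))) (σ + t * I) =
      Complex.Gamma (σ + t * I) * s ^ (-((σ : ℂ) + t * I)) := by
    rw [mul_comm (Complex.Gamma _),
      ← integral_cpow_mul_exp_neg_mul_Ioi_of_re_pos (by simpa using hσ) hs]
    rfl
  have h := mellinInv_mellin_eq σ (fun x : ℝ ↦ Complex.exp (-(s * x))) hx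
    (integrableOn_cpow_mul_exp_neg_mul_Ioi (by simpa using hσ) hs)
    ((verticalIntegrable_Gamma_mul_cpow_neg hσ hs).congr
      (Eventually.of_forall fun t ↦ (hm t).symm)) (by fun_prop)
  rw [← h, mellinInv]
  simp_rw [hm, smul_eq_mul, real_smul]
  push_cast
  have hpi : (2 * Real.pi : ℂ) ≠ 0 := by exact_mod_cast Real.two_pi_pos.ne'
  rw [one_div, mul_inv_cancel_left₀ hpi]

theorem hasSum_exp_neg_mul_div {w : ℂ} (hw : 0 < w.re) :
    HasSum (fun n : ℕ ↦ Complex.exp (-(w * (n + 1))) / (n + 1))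
      (-Complex.log (1 - Complex.exp (-w))) := by
  have h := Complex.hasSum_taylorSeries_neg_log (z := Complex.exp (-w))
    (by rw [Complex.norm_exp]; simpa using hw)
  rw [← hasSum_nat_add_iff' 1] at h
  convert! h using 1
  · ext n
    rw [← Complex.exp_nat_mul]
    push_cast
    ring_nf
  · simp

theorem summable_norm_one_div_nat_add_one_cpow {z : ℂ} (hz : 1 < z.re) :
    Summable fun n : ℕ ↦ ‖1 / ((n : ℂ) + 1) ^ z‖ := by
  have := ((summable_nat_add_iff 1).2 (Complex.summable_one_div_nat_cpow.2 hz)).norm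
  simpa using this

theorem Phi_mellin (k : ℕ) (hk : 1 ≤ k) (s : ℂ) (hs : 0 < s.re) :
    ∑' m : ℕ, -Complex.log (1 - Complex.exp (-((m + 1 : ℕ) : ℂ) ^ k * s)) =
      (2 * (Real.pi : ℂ) * Complex.I)⁻¹ *
        ∫ t : ℝ,
          riemannZeta (((2 : ℂ) + t * Complex.I) + 1) *
            riemannZeta ((k : ℂ) * ((2 : ℂ) + t * Complex.I)) *
            Complex.Gamma ((2 : ℂ) + t * Complex.I) *
            s ^ (-((2 : ℂ) + t * Complex.I)) * Complex.I := by
  have hk' : (1 : ℝ) ≤ k := by exact_mod_cast hk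
  obtain ⟨G, hGdef⟩ : ∃ G : ℝ → ℂ,
      ∀ t : ℝ, G t = Complex.Gamma (2 + t * I) * s ^ (-((2 : ℂ) + t * I)) := ⟨_, fun _ ↦ rfl⟩
  have hG : Integrable G := by
    refine (verticalIntegrable_Gamma_mul_cpow_neg two_pos hs).congr
      (Eventually.of_forall fun t ↦ ?_)
    simp only [hGdef, ofReal_ofNat]
  let c : ℕ × ℕ → ℝ := fun p ↦ ((p.1 : ℝ) + 1) ^ k * (p.2 + 1)
  have hc (p : ℕ × ℕ) : 0 < c p := by positivity
  obtain ⟨F, hFdef⟩ : ∃ F : ℕ × ℕ → ℝ → ℂ, ∀ p, F p = fun t : ℝ ↦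
      (c p : ℂ) ^ (-((2 : ℂ) + t * I)) * G t * ((p.2 : ℂ) + 1)⁻¹ := ⟨_, fun _ ↦ rfl⟩
  have hFeq (p : ℕ × ℕ) (t : ℝ) : F p t =
      1 / ((p.1 : ℂ) + 1) ^ ((k : ℂ) * (2 + t * I)) * (1 / ((p.2 : ℂ) + 1) ^ ((2 : ℂ) + t * I + 1)) *
        G t := by
    have hp : ((p.2 : ℂ) + 1) ≠ 0 := by exact_mod_cast p.2.succ_ne_zero
    have h1 : (c p : ℂ) = (((p.1 + 1) ^ k : ℕ) : ℂ) * ((p.2 + 1 : ℕ) : ℂ) := by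
      simp [c]
    have h2 := Complex.natCast_cpow_natCast_mul (p.1 + 1) k (2 + t * I)
    push_cast at h2
    simp only [hFdef]
    rw [cpow_neg, h1, Complex.natCast_mul_natCast_cpow]
    push_cast
    rw [← h2, cpow_add _ 1 hp, cpow_one, mul_inv, one_div, one_div, mul_inv]
    ring
  have hFnorm (p : ℕ × ℕ) (t : ℝ) : ‖F p t‖ =
      ‖1 / ((p.1 : ℂ) + 1) ^ ((k : ℂ) * 2) * (1 / ((p.2 : ℂ) + 1) ^ (3 : ℂ))‖ * ‖G t‖ := by
    rw [hFeq, norm_mul]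
    have h (n : ℕ) (z w : ℂ) (hzw : z.re = w.re) : ‖1 / ((n : ℂ) + 1) ^ z‖ =
        ‖1 / ((n : ℂ) + 1) ^ w‖ := by
      have h1 : (n : ℂ) + 1 = (n + 1 : ℕ) := by push_cast; rfl
      rw [norm_div, norm_div, h1, norm_natCast_cpow_of_pos n.succ_pos,
        norm_natCast_cpow_of_pos n.succ_pos, hzw]
    rw [norm_mul, norm_mul, h p.1 _ ((k : ℂ) * 2) (by simp), h p.2 _ 3 (by norm_num)]
  have hFint (p : ℕ × ℕ) : Integrable (F p) := by
    refine (hG.norm.const_mul _).mono' ?_ (Eventually.of_forall fun t ↦ (hFnorm p t).le)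
    rw [hFdef]
    refine (AEStronglyMeasurable.mul
      (Continuous.aestronglyMeasurable ?_) hG.aestronglyMeasurable).mul_const _
    exact Continuous.const_cpow (by fun_prop) (Or.inl (by exact_mod_cast (hc p).ne'))
  have hsum : Summable fun p ↦ ∫ t, ‖F p t‖ := by
    have h1 : 1 < ((k : ℂ) * 2).re := by simp; linarith
    have h2 : 1 < (3 : ℂ).re := by norm_num
    have h := (summable_norm_one_div_nat_add_one_cpow h1).mul_norm
      (summable_norm_one_div_nat_add_one_cpow h2)
    simp_rw [hFnorm, integral_const_mul]
    exact h.mul_right _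
  have hmain := hasSum_integral_of_summable_integral_norm hFint hsum
  have hval (p : ℕ × ℕ) : ∫ t, F p t =
      2 * Real.pi * (Complex.exp (-(((p.1 : ℂ) + 1) ^ k * s * (p.2 + 1))) / (p.2 + 1)) := by
    have h := integral_cpow_neg_mul_Gamma_mul_cpow_neg two_pos hs (hc p)
    simp_rw [hFdef, integral_mul_const, hGdef]
    rw [ofReal_ofNat] at h
    rw [h]
    simp only [c]
    push_cast
    ring_nf
  have hζ (t : ℝ) : ∑' p, F p t =
      riemannZeta ((2 : ℂ) + t * I + 1) * riemannZeta ((k : ℂ) * ((2 : ℂ) + t * I)) * G t := by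
    simp_rw [hFeq, tsum_mul_right]
    have hr1 : 1 < ((k : ℂ) * (2 + t * I)).re := by simp; linarith
    have hr2 : 1 < ((2 : ℂ) + t * I + 1).re := by norm_num
    rw [zeta_eq_tsum_one_div_nat_add_one_cpow hr1, zeta_eq_tsum_one_div_nat_add_one_cpow hr2,
      ← tsum_mul_tsum_of_summable_norm (summable_norm_one_div_nat_add_one_cpow hr1)
      (summable_norm_one_div_nat_add_one_cpow hr2), mul_comm (tsum _) (tsum _)]
  have hpi : (2 * Real.pi : ℂ) ≠ 0 := by exact_mod_cast Real.two_pi_pos.ne'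
  have hsplit : ∫ t, ∑' p, F p t = 2 * Real.pi *
      ∑' m : ℕ, -Complex.log (1 - Complex.exp (-((m + 1 : ℕ) : ℂ) ^ k * s)) := by
    rw [← hmain.tsum_eq, hmain.summable.tsum_prod]
    simp_rw [hval, tsum_mul_left]
    congr 2 with m
    have hre : 0 < (((m : ℂ) + 1) ^ k * s).re := by
      have : ((m : ℂ) + 1) ^ k = (((m + 1) ^ k : ℝ) : ℂ) := by push_cast; rfl
      rw [this, re_ofReal_mul]
      positivity
    rw [(hasSum_exp_neg_mul_div hre).tsum_eq]
    push_cast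
    rw [neg_mul]
  rw [integral_mul_const]
  simp_rw [hζ] at hsplit
  simp only [hGdef, ← mul_assoc] at hsplit
  rw [hsplit, mul_right_comm (2 * (Real.pi : ℂ)) _ I,
    inv_mul_cancel_left₀ (mul_ne_zero hpi I_ne_zero)]
end

section
/- As n → ∞, −Φ_k'(σ_n) = n satisfies the asymptotic n = a_k^{1+1/k}/σ_n^{1+1/k} − 1/(2σ_n) − ζ(−k)/2 + O(σ_n), where a_k := (k^{-1} ζ(1+1/k) Γ(1+1/k))^{k/(k+1)}. -/
open Real

/-- `Φ_k(σ) = ∑_{m ≥ 1} -log(1 - e^{-m^k σ})` for real `σ > 0`. -/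
noncomputable def Phi (k : ℕ) (σ : ℝ) : ℝ :=
  ∑' m : ℕ, -Real.log (1 - Real.exp (-((m + 1 : ℕ) : ℝ) ^ k * σ))

/-- `a_k = (k⁻¹ ζ(1 + 1/k) Γ(1 + 1/k))^{k/(k+1)}`. -/
noncomputable def ak (k : ℕ) : ℝ :=
  ((k : ℝ)⁻¹ * (riemannZeta (1 + 1 / (k : ℂ))).re * Real.Gamma (1 + 1 / (k : ℝ))) ^
    ((k : ℝ) / (k + 1))

section

open Filter Topology Asymptotics MeasureTheory Set
open scoped ContDiff Nat

/-- Integration by parts against a Bernoulli polynomial on a unit interval. -/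
theorem integral_bernoulliFun_mul_comp_add {f : ℝ → ℝ} (hf : ContDiff ℝ ∞ f) (n : ℕ) (a : ℝ) :
    ∫ x in (0 : ℝ)..1, bernoulliFun n x / n ! * iteratedDeriv n f (a + x) =
      bernoulliFun (n + 1) 1 / (n + 1)! * iteratedDeriv n f (a + 1)
        - bernoulliFun (n + 1) 0 / (n + 1)! * iteratedDeriv n f a
        - ∫ x in (0 : ℝ)..1, bernoulliFun (n + 1) x / (n + 1)! *
            iteratedDeriv (n + 1) f (a + x) := by
  have hc : ∀ j, Continuous (iteratedDeriv j f) := fun j =>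
    hf.continuous_iteratedDeriv j (by exact_mod_cast le_top)
  have hd : ∀ x, HasDerivAt (iteratedDeriv n f) (iteratedDeriv (n + 1) f x) x := fun x => by
    rw [iteratedDeriv_succ]
    exact (hf.differentiable_iteratedDeriv n (by exact_mod_cast ENat.natCast_lt_top n) x).hasDerivAt
  have hb : ∀ x, HasDerivAt (fun x => bernoulliFun (n + 1) x / (n + 1)!)
      (bernoulliFun n x / n !) x := fun x => by
    convert! (hasDerivAt_bernoulliFun (n + 1) x).div_const ((n + 1)! : ℝ) using 1
    rw [Nat.factorial_succ]
    have := Nat.factorial_ne_zero n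
    push_cast
    field_simp
  have hd' : ∀ x, HasDerivAt (fun x => iteratedDeriv n f (a + x))
      (iteratedDeriv (n + 1) f (a + x)) x := fun x =>
    (hd (a + x)).comp_const_add a x
  have hcn := hc n
  have hcn' := hc (n + 1)
  have key := intervalIntegral.integral_mul_deriv_eq_deriv_mul (a := (0 : ℝ)) (b := 1)
    (fun x _ => hb x) (fun x _ => hd' x)
    (Continuous.intervalIntegrable (by fun_prop) _ _)
    (Continuous.intervalIntegrable (by fun_prop) _ _)
  rw [key, add_zero]
  ring

/-- The Euler–Maclaurin formula on `[0, M]`. -/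
theorem euler_maclaurin_finite {f : ℝ → ℝ} (hf : ContDiff ℝ ∞ f) (M N : ℕ) :
    ∫ x in (0 : ℝ)..M, f x = ∑ m ∈ Finset.range M, (f m + f (m + 1)) / 2
      + ∑ n ∈ Finset.range N, (-1) ^ (n + 1) * (bernoulliFun (n + 2) 0 / (n + 2)!) *
          (iteratedDeriv (n + 1) f M - iteratedDeriv (n + 1) f 0)
      + (-1) ^ (N + 1) * ∑ m ∈ Finset.range M, ∫ x in (0 : ℝ)..1,
          bernoulliFun (N + 1) x / (N + 1)! * iteratedDeriv (N + 1) f (m + x) := by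
  induction N with
  | zero =>
    have h0 : ∀ m : ℕ, ∫ x in (m : ℝ)..(m + 1 : ℕ), f x = (f m + f (m + 1)) / 2 -
        ∫ x in (0 : ℝ)..1, bernoulliFun 1 x / 1 ! * iteratedDeriv 1 f (m + x) := fun m => by
      have h := integral_bernoulliFun_mul_comp_add hf 0 m
      simp only [bernoulliFun_zero, iteratedDeriv_zero, Nat.factorial, Nat.cast_one, div_one,
        one_mul, zero_add, mul_one] at h
      rw [intervalIntegral.integral_comp_add_left (fun x => f x) (m : ℝ)] at h
      rw [add_zero] at h
      push_cast
      rw [h]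
      simp only [bernoulliFun_one, Nat.factorial, Nat.cast_one, div_one, mul_one]
      ring
    have hs := intervalIntegral.sum_integral_adjacent_intervals (f := f) (μ := volume)
      (a := fun m : ℕ => (m : ℝ)) (n := M)
      (fun _ _ => hf.continuous.intervalIntegrable _ _)
    simp only [Nat.cast_zero] at hs
    rw [← hs, Finset.sum_congr rfl fun m _ => h0 m, Finset.sum_sub_distrib]
    simp
    ring
  | succ N ih =>
    have hstep : ∀ m : ℕ, _ := fun m => integral_bernoulliFun_mul_comp_add hf (N + 1) (m : ℝ)
    rw [ih, Finset.sum_range_succ, Finset.sum_congr rfl fun m _ => hstep m,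
      Finset.sum_sub_distrib]
    have e : ∀ m : ℕ, bernoulliFun (N + 1 + 1) 1 / (N + 1 + 1)! * iteratedDeriv (N + 1) f (m + 1)
        - bernoulliFun (N + 1 + 1) 0 / (N + 1 + 1)! * iteratedDeriv (N + 1) f m =
        bernoulliFun (N + 2) 0 / (N + 2)! *
          (iteratedDeriv (N + 1) f (m + 1 : ℕ) - iteratedDeriv (N + 1) f m) := fun m => by
      rw [bernoulliFun_endpoints_eq_of_ne_one (by omega)]
      push_cast
      ring
    rw [Finset.sum_congr rfl fun m _ => e m, ← Finset.mul_sum,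
      Finset.sum_range_sub (fun m : ℕ => iteratedDeriv (N + 1) f m)]
    push_cast
    ring

theorem summable_comp_natCast_add_one_of_isBigO_exp_neg {f : ℝ → ℝ} {b : ℝ} (hb : 0 < b)
    (hf : f =O[atTop] fun x => exp (-b * x)) : Summable fun m : ℕ => f (m + 1) := by
  have h := hf.comp_tendsto (tendsto_natCast_atTop_atTop (R := ℝ))
  have h2 : Summable fun m : ℕ => f m := by
    refine summable_of_isBigO_nat (g := fun m : ℕ => exp (-b * m)) ?_ h
    simpa [mul_comm] using Real.summable_exp_nat_mul_iff.mpr (neg_lt_zero.mpr hb)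
  simpa using (summable_nat_add_iff 1).mpr h2

/-- The Euler–Maclaurin formula on `[0, ∞)` for exponentially decaying functions. -/
theorem exists_euler_maclaurin_bound (N : ℕ) :
    ∃ C : ℝ, ∀ (f : ℝ → ℝ) (b : ℝ), ContDiff ℝ ∞ f → 0 < b →
      (∀ n, iteratedDeriv n f =O[atTop] fun x => exp (-b * x)) →
      |∑' m : ℕ, f (m + 1) - (∫ x in Ioi 0, f x) + f 0 / 2
        - ∑ n ∈ Finset.range N, (-1) ^ (n + 1) * (bernoulliFun (n + 2) 0 / (n + 2)!) *
            iteratedDeriv (n + 1) f 0| ≤ C * ∫ x in Ioi 0, |iteratedDeriv (N + 1) f x| := by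
  obtain ⟨C, hC⟩ := (isCompact_Icc (a := (0 : ℝ)) (b := 1)).exists_bound_of_continuousOn
    ((continuous_bernoulliFun (N + 1)).div_const ((N + 1)! : ℝ)).continuousOn
  refine ⟨C, fun f b hf hb hd => ?_⟩
  have hC0 : 0 ≤ C := (norm_nonneg _).trans (hC 0 (by simp))
  have hc : ∀ j, Continuous (iteratedDeriv j f) := fun j =>
    hf.continuous_iteratedDeriv j (by exact_mod_cast le_top)
  have hi : ∀ j, IntegrableOn (iteratedDeriv j f) (Ioi 0) := fun j =>
    integrable_of_isBigO_exp_neg hb (hc j).continuousOn (hd j)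
  have ht : ∀ j, Tendsto (fun M : ℕ => iteratedDeriv j f M) atTop (𝓝 0) := fun j => by
    refine ((hd j).trans_tendsto ?_).comp tendsto_natCast_atTop_atTop
    exact tendsto_exp_atBot.comp (tendsto_id.const_mul_atTop_of_neg (neg_lt_zero.mpr hb))
  have hd0 : f =O[atTop] fun x => exp (-b * x) := by simpa using hd 0
  have hi0 : IntegrableOn f (Ioi 0) := by simpa using hi 0
  have ht0 : Tendsto (fun M : ℕ => f M) atTop (𝓝 0) := by simpa using ht 0
  have hS := (summable_comp_natCast_add_one_of_isBigO_exp_neg hb hd0).hasSum.tendsto_sum_nat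
  have hI := intervalIntegral_tendsto_integral_Ioi (0 : ℝ) hi0
    (tendsto_natCast_atTop_atTop (R := ℝ))
  have hB : Tendsto (fun M : ℕ => ∑ n ∈ Finset.range N,
      (-1) ^ (n + 1) * (bernoulliFun (n + 2) 0 / (n + 2)!) *
        (iteratedDeriv (n + 1) f M - iteratedDeriv (n + 1) f 0)) atTop
      (𝓝 (∑ n ∈ Finset.range N, (-1) ^ (n + 1) * (bernoulliFun (n + 2) 0 / (n + 2)!) *
        (0 - iteratedDeriv (n + 1) f 0))) :=
    tendsto_finsetSum _ fun n _ => ((ht (n + 1)).sub_const _).const_mul _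
  have hL := ((((hS.sub hI).add_const (f 0 / 2)).sub (ht0.div_const 2)).add hB).abs
  have hfin : ∀ M : ℕ, |∑ m ∈ Finset.range M, f (m + 1) - (∫ x in (0 : ℝ)..M, f x) + f 0 / 2
      - f M / 2 + ∑ n ∈ Finset.range N, (-1) ^ (n + 1) * (bernoulliFun (n + 2) 0 / (n + 2)!) *
        (iteratedDeriv (n + 1) f M - iteratedDeriv (n + 1) f 0)| ≤
      C * ∫ x in Ioi 0, |iteratedDeriv (N + 1) f x| := fun M => by
    have htrap : ∑ m ∈ Finset.range M, (f m + f (m + 1)) / 2 =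
        ∑ m ∈ Finset.range M, f (m + 1) + f 0 / 2 - f M / 2 := by
      clear * -
      induction M with
      | zero => simp
      | succ M ih => rw [Finset.sum_range_succ, ih, Finset.sum_range_succ]; push_cast; ring
    have hEM := euler_maclaurin_finite hf M N
    rw [htrap] at hEM
    have hterm : ∀ m : ℕ, |∫ x in (0 : ℝ)..1,
        bernoulliFun (N + 1) x / (N + 1)! * iteratedDeriv (N + 1) f (m + x)| ≤
        C * ∫ x in (m : ℝ)..(m + 1 : ℕ), |iteratedDeriv (N + 1) f x| := fun m => by
      have hsh := intervalIntegral.integral_comp_add_left (a := 0) (b := 1)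
        (fun x => |iteratedDeriv (N + 1) f x|) (m : ℝ)
      rw [add_zero] at hsh
      push_cast
      have hcN := hc (N + 1)
      rw [← hsh, ← intervalIntegral.integral_const_mul, ← Real.norm_eq_abs]
      refine intervalIntegral.norm_integral_le_of_norm_le (μ := volume) (g := fun x =>
        C * |iteratedDeriv (N + 1) f (m + x)|) zero_le_one ?_
        (Continuous.intervalIntegrable (by fun_prop) _ _)
      refine ae_of_all _ fun x hx => ?_
      rw [norm_mul, Real.norm_eq_abs (iteratedDeriv _ _ _)]
      exact mul_le_mul_of_nonneg_right (hC x ⟨hx.1.le, hx.2⟩) (abs_nonneg _)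
    have hsum := intervalIntegral.sum_integral_adjacent_intervals
      (f := fun x => |iteratedDeriv (N + 1) f x|) (μ := volume)
      (a := fun m : ℕ => (m : ℝ)) (n := M)
      (fun _ _ => (hc (N + 1)).abs.intervalIntegrable _ _)
    simp only [Nat.cast_zero] at hsum
    calc _ = |(-1) ^ (N + 1) * ∑ m ∈ Finset.range M, ∫ x in (0 : ℝ)..1,
          bernoulliFun (N + 1) x / (N + 1)! * iteratedDeriv (N + 1) f (m + x)| := by
          rw [hEM, ← abs_neg]
          congr 1
          ring
      _ = |∑ m ∈ Finset.range M, ∫ x in (0 : ℝ)..1,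
          bernoulliFun (N + 1) x / (N + 1)! * iteratedDeriv (N + 1) f (m + x)| := by
          rw [abs_mul, abs_neg_one_pow, one_mul]
      _ ≤ ∑ m ∈ Finset.range M, C * ∫ x in (m : ℝ)..(m + 1 : ℕ), |iteratedDeriv (N + 1) f x| :=
          (Finset.abs_sum_le_sum_abs _ _).trans (Finset.sum_le_sum fun m _ => hterm m)
      _ = C * ∫ x in (0 : ℝ)..M, |iteratedDeriv (N + 1) f x| := by rw [← Finset.mul_sum, hsum]
      _ ≤ _ := by
          refine mul_le_mul_of_nonneg_left ?_ hC0
          rw [intervalIntegral.integral_of_le (Nat.cast_nonneg M)]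
          exact setIntegral_mono_set (hi (N + 1)).abs (ae_of_all _ fun _ => abs_nonneg _)
            (Ioc_subset_Ioi_self.eventuallyLE)
  refine (le_of_eq ?_).trans (le_of_tendsto' hL hfin)
  congr 1
  simp only [zero_sub, mul_neg, Finset.sum_neg_distrib, zero_div, sub_zero]
  ring

end

section

open Filter Topology Asymptotics MeasureTheory Set
open scoped ContDiff Nat

theorem AnalyticAt.dslope {f : ℝ → ℝ} {a x : ℝ} (hf : AnalyticAt ℝ f x) :
    AnalyticAt ℝ (dslope f a) x := by
  rcases eq_or_ne x a with rfl | hx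
  · obtain ⟨p, hp⟩ := hf
    exact hp.has_fpower_series_dslope_fslope.analyticAt
  · have h : AnalyticAt ℝ (fun y => (y - a)⁻¹ * (f y - f a)) x :=
      ((analyticAt_id.sub analyticAt_const).inv (sub_ne_zero.mpr hx)).mul
        (hf.sub analyticAt_const)
    refine h.congr ?_
    filter_upwards [isOpen_ne.mem_nhds hx] with y hy
    rw [dslope_of_ne _ hy, slope_def_field, div_eq_inv_mul]

theorem eq_add_mul_dslope (f : ℝ → ℝ) (x : ℝ) : f x = f 0 + x * dslope f 0 x := by
  have := sub_smul_dslope f 0 x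
  rw [sub_zero, smul_eq_mul] at this
  linarith

/-- The function `x / (e^x - 1)`, extended to `x = 0` by the value `1`. -/
noncomputable def boseKernel (x : ℝ) : ℝ := (dslope exp 0 x)⁻¹

theorem boseKernel_of_ne_zero {x : ℝ} (hx : x ≠ 0) : boseKernel x = x * (exp x - 1)⁻¹ := by
  rw [boseKernel, dslope_of_ne _ hx, slope_def_field, exp_zero, sub_zero, inv_div,
    div_eq_mul_inv]

theorem boseKernel_zero : boseKernel 0 = 1 := by
  simp [boseKernel]

theorem boseKernel_ne_zero (x : ℝ) : boseKernel x ≠ 0 := by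
  rcases eq_or_ne x 0 with rfl | hx
  · simp [boseKernel_zero]
  · rw [boseKernel_of_ne_zero hx]
    have : exp x - 1 ≠ 0 := sub_ne_zero.mpr (by simpa using hx)
    positivity

theorem analyticAt_boseKernel (x : ℝ) : AnalyticAt ℝ boseKernel x :=
  (analyticAt_rexp.dslope).inv (by simpa [boseKernel] using boseKernel_ne_zero x)

theorem boseKernel_neg (x : ℝ) : boseKernel (-x) = boseKernel x + x := by
  rcases eq_or_ne x 0 with rfl | hx
  · simp
  · rw [boseKernel_of_ne_zero hx, boseKernel_of_ne_zero (neg_ne_zero.mpr hx), exp_neg]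
    have h1 : exp x - 1 ≠ 0 := sub_ne_zero.mpr (by simpa using hx)
    have h2 : (exp x)⁻¹ - 1 ≠ 0 := by
      rw [← exp_neg]
      exact sub_ne_zero.mpr (by simpa using hx)
    have h3 : 1 - exp x ≠ 0 := by rw [← neg_sub]; exact neg_ne_zero.mpr h1
    field_simp
    ring

theorem deriv_boseKernel_zero : deriv boseKernel 0 = -1 / 2 := by
  have h := (analyticAt_boseKernel 0).differentiableAt.hasDerivAt
  have h0 : HasDerivAt boseKernel (deriv boseKernel 0) (-0) := by rwa [neg_zero]
  have h1 := h0.comp (0 : ℝ) (hasDerivAt_neg (0 : ℝ))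
  have h2 := h.add (hasDerivAt_id (0 : ℝ))
  have h3 : boseKernel ∘ Neg.neg = boseKernel + id := by
    ext x
    simp [boseKernel_neg]
  rw [h3] at h1
  linarith [h1.unique h2]

theorem exists_boseKernel_expansion :
    ∃ h : ℝ → ℝ, ContDiff ℝ ∞ h ∧ ∀ x, boseKernel x = 1 - x / 2 + x ^ 2 * h x := by
  refine ⟨dslope (dslope boseKernel 0) 0, ?_, fun x => ?_⟩
  · exact (contDiff_iff_contDiffAt.mpr fun x =>
      (analyticAt_boseKernel x).dslope.dslope.contDiffAt)
  · rw [eq_add_mul_dslope boseKernel x, eq_add_mul_dslope (dslope boseKernel 0) x, dslope_same,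
      deriv_boseKernel_zero, boseKernel_zero]
    ring

theorem contDiff_boseKernel_pow (k : ℕ) : ContDiff ℝ ∞ fun y => boseKernel (y ^ k) :=
  ContDiff.comp (g := boseKernel)
    (contDiff_iff_contDiffAt.mpr fun x => (analyticAt_boseKernel x).contDiffAt)
    (contDiff_id.pow k)

theorem iteratedDeriv_pow_mul_zero {h : ℝ → ℝ} (hh : ContDiff ℝ ∞ h) {n p : ℕ} (hn : n < p) :
    iteratedDeriv n (fun y => y ^ p * h y) 0 = 0 := by
  rw [iteratedDeriv_fun_mul (by fun_prop) (hh.contDiffAt.of_le (by exact_mod_cast le_top))]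
  refine Finset.sum_eq_zero fun i hi => ?_
  rw [iteratedDeriv_fun_pow_zero, if_neg (by simp at hi; omega)]
  simp

theorem iteratedDeriv_boseKernel_pow_zero {k n : ℕ} (hn : n ≠ 0) (hnk : n < 2 * k) :
    iteratedDeriv n (fun y => boseKernel (y ^ k)) 0 = if n = k then -(k ! : ℝ) / 2 else 0 := by
  obtain ⟨h, hh, he⟩ := exists_boseKernel_expansion
  have e : (fun y : ℝ => boseKernel (y ^ k)) =
      fun y => 1 + ((-1 / 2) * y ^ k + y ^ (2 * k) * h (y ^ k)) := by
    ext y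
    rw [he]
    ring
  have hc : ContDiff ℝ ∞ fun y : ℝ => h (y ^ k) := hh.comp (contDiff_id.pow k)
  have hcn : ContDiff ℝ n fun y : ℝ => h (y ^ k) := hc.of_le (by exact_mod_cast le_top)
  have hp : ContDiff ℝ n fun y : ℝ => y ^ (2 * k) * h (y ^ k) := (contDiff_id.pow _).mul hcn
  rw [e, iteratedDeriv_const_add (Nat.pos_of_ne_zero hn), iteratedDeriv_fun_add (by fun_prop)
    hp.contDiffAt, iteratedDeriv_pow_mul_zero hc hnk, iteratedDeriv_const_mul_field,
    iteratedDeriv_fun_pow_zero]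
  split_ifs <;> ring

/-- The span of the functions `y^a (e^{y^k} - 1)^{-(b+1)}`. -/
noncomputable def boseSpan (k : ℕ) : Submodule ℝ (ℝ → ℝ) :=
  Submodule.span ℝ (range fun p : ℕ × ℕ => fun y : ℝ =>
    y ^ p.1 * (exp (y ^ k) - 1)⁻¹ ^ (p.2 + 1))

theorem mem_boseSpan (k a b : ℕ) :
    (fun y : ℝ => y ^ a * (exp (y ^ k) - 1)⁻¹ ^ (b + 1)) ∈ boseSpan k :=
  Submodule.subset_span ⟨(a, b), rfl⟩

theorem exp_pow_sub_one_pos (k : ℕ) {y : ℝ} (hy : 0 < y) : 0 < exp (y ^ k) - 1 :=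
  sub_pos.mpr (one_lt_exp_iff.mpr (by positivity))

theorem exists_hasDerivAt_mem_boseSpan (k : ℕ) {f : ℝ → ℝ} (hf : f ∈ boseSpan k) :
    ∃ g ∈ boseSpan k, ∀ y, 0 < y → HasDerivAt f (g y) y := by
  induction hf using Submodule.span_induction with
  | mem f hf =>
    obtain ⟨⟨a, b⟩, rfl⟩ := hf
    refine ⟨(a : ℝ) • (fun y : ℝ => y ^ (a - 1) * (exp (y ^ k) - 1)⁻¹ ^ (b + 1)) +
      (-((b + 1) * k : ℝ)) • ((fun y : ℝ => y ^ (a + (k - 1)) * (exp (y ^ k) - 1)⁻¹ ^ (b + 1)) +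
        (fun y : ℝ => y ^ (a + (k - 1)) * (exp (y ^ k) - 1)⁻¹ ^ (b + 1 + 1))), ?_,
      fun y hy => ?_⟩
    · exact add_mem (Submodule.smul_mem _ _ (mem_boseSpan _ _ _))
        (Submodule.smul_mem _ _ (add_mem (mem_boseSpan _ _ _) (mem_boseSpan _ _ _)))
    · have hu := (exp_pow_sub_one_pos k hy).ne'
      have hd := (((hasDerivAt_pow k y).exp.sub_const 1).inv hu).pow (b + 1)
      convert! (hasDerivAt_pow a y).mul hd using 1
      simp only [Pi.add_apply, Pi.smul_apply, smul_eq_mul, Nat.add_sub_cancel, pow_add,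
        Pi.inv_apply, Pi.pow_apply]
      push_cast
      field_simp
      ring
  | zero => exact ⟨0, zero_mem _, fun y _ => hasDerivAt_const _ _⟩
  | add f₁ f₂ _ _ h₁ h₂ =>
    obtain ⟨g₁, hg₁, hd₁⟩ := h₁
    obtain ⟨g₂, hg₂, hd₂⟩ := h₂
    exact ⟨g₁ + g₂, add_mem hg₁ hg₂, fun y hy => (hd₁ y hy).add (hd₂ y hy)⟩
  | smul c f _ h =>
    obtain ⟨g, hg, hd⟩ := h
    exact ⟨c • g, Submodule.smul_mem _ _ hg, fun y hy => (hd y hy).const_smul c⟩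

theorem inv_exp_pow_sub_one_le {k : ℕ} (hk : 1 ≤ k) {y : ℝ} (hy : 1 ≤ y) :
    (exp (y ^ k) - 1)⁻¹ ≤ 2 * exp (-y) := by
  have h1 : exp y ≤ exp (y ^ k) := exp_le_exp.mpr (le_self_pow₀ hy (by omega))
  have h2 : 2 ≤ exp y := by linarith [add_one_le_exp y]
  rw [exp_neg, ← div_eq_mul_inv, inv_le_comm₀ (by linarith) (by positivity), inv_div]
  linarith

theorem isBigO_exp_neg_of_mem_boseSpan {k : ℕ} (hk : 1 ≤ k) {f : ℝ → ℝ} (hf : f ∈ boseSpan k) :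
    f =O[atTop] fun y => exp (-(1 / 2) * y) := by
  induction hf using Submodule.span_induction with
  | mem f hf =>
    obtain ⟨⟨a, b⟩, rfl⟩ := hf
    have h1 : (fun y : ℝ => y ^ a * (exp (y ^ k) - 1)⁻¹ ^ (b + 1)) =O[atTop]
        fun y => y ^ a * exp (-y) := by
      refine (isBigO_refl _ _).mul (IsBigO.of_bound 2 ?_)
      filter_upwards [eventually_ge_atTop 1] with y hy
      have hu := exp_pow_sub_one_pos k (zero_lt_one.trans_le hy)
      have hle := inv_exp_pow_sub_one_le hk hy
      have h3 : 2 * exp (-y) ≤ 1 := by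
        rw [exp_neg, ← div_eq_mul_inv, div_le_one (exp_pos _)]
        linarith [add_one_le_exp y]
      rw [norm_of_nonneg (by positivity), norm_of_nonneg (exp_pos _).le]
      exact (pow_le_of_le_one (by positivity) (hle.trans h3) (by omega)).trans hle
    have h2 := (isLittleO_pow_exp_pos_mul_atTop a (b := 1 / 2) (by norm_num)).isBigO.mul
      (isBigO_refl (fun y : ℝ => exp (-y)) atTop)
    refine h1.trans (h2.congr_right fun y => ?_)
    rw [← exp_add]
    congr 1
    ring
  | zero => exact isBigO_zero _ _
  | add f₁ f₂ _ _ h₁ h₂ => exact h₁.add h₂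
  | smul c f _ h => exact h.const_smul_left c

theorem isBigO_iteratedDeriv_boseKernel_pow {k : ℕ} (hk : 1 ≤ k) (n : ℕ) :
    iteratedDeriv n (fun y => boseKernel (y ^ k)) =O[atTop] fun y => exp (-(1 / 2) * y) := by
  have h : ∃ g ∈ boseSpan k, ∀ y, 0 < y →
      iteratedDeriv n (fun y => boseKernel (y ^ k)) y = g y := by
    induction n with
    | zero =>
      refine ⟨_, mem_boseSpan k k 0, fun y hy => ?_⟩
      simp [boseKernel_of_ne_zero (pow_pos hy k).ne']
    | succ n ih =>
      obtain ⟨g, hg, he⟩ := ih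
      obtain ⟨g', hg', hd⟩ := exists_hasDerivAt_mem_boseSpan k hg
      refine ⟨g', hg', fun y hy => ?_⟩
      rw [iteratedDeriv_succ, EventuallyEq.deriv_eq (f := g) ?_, (hd y hy).deriv]
      filter_upwards [Ioi_mem_nhds hy] with z hz using he z hz
  obtain ⟨g, hg, he⟩ := h
  refine (isBigO_exp_neg_of_mem_boseSpan hk hg).congr' ?_ EventuallyEq.rfl
  filter_upwards [eventually_gt_atTop 0] with y hy using (he y hy).symm

end

section

open Filter Topology Asymptotics MeasureTheory Set
open scoped ContDiff Nat

theorem hasSum_exp_neg_nat_add_one_mul {t : ℝ} (ht : 0 < t) :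
    HasSum (fun n : ℕ => exp (-((n : ℝ) + 1) * t)) (exp t - 1)⁻¹ := by
  have h := (hasSum_geometric_of_lt_one (exp_pos (-t)).le
    (exp_lt_one_iff.mpr (neg_lt_zero.mpr ht))).mul_left (exp (-t))
  convert! h using 1
  · ext n
    rw [← exp_nat_mul, ← exp_add]
    congr 1
    ring
  · rw [exp_neg]
    have h1 : exp t - 1 ≠ 0 := (sub_pos.mpr (one_lt_exp_iff.mpr ht)).ne'
    have h2 : 1 - (exp t)⁻¹ ≠ 0 := by
      rw [← exp_neg]
      exact (sub_pos.mpr (exp_lt_one_iff.mpr (neg_lt_zero.mpr ht))).ne'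
    field_simp

/-- The Bose–Einstein integral. -/
theorem integral_rpow_mul_inv_exp_sub_one {s : ℝ} (hs : 1 < s) :
    ∫ x in Ioi 0, x ^ (s - 1) * (exp x - 1)⁻¹ = Gamma s * (riemannZeta s).re := by
  have h := hasSum_mellin (a := fun _ : ℕ => 1) (p := fun n => (n : ℝ) + 1)
    (F := fun t => ((exp t - 1)⁻¹ : ℝ)) (s := s) (fun n => Or.inr (by positivity))
    (by simpa using zero_lt_one.trans hs)
    (fun t ht => by
      simpa only [one_mul] using (Complex.hasSum_ofReal.mpr (hasSum_exp_neg_nat_add_one_mul ht)))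
    (by
      have := (Real.summable_one_div_nat_add_rpow 1 s).mpr hs
      refine this.congr fun n => ?_
      rw [abs_of_nonneg (by positivity)]
      simp)
  have hz : mellin (fun t : ℝ => (((exp t - 1)⁻¹ : ℝ) : ℂ)) s =
      Complex.Gamma s * riemannZeta s := by
    rw [zeta_eq_tsum_one_div_nat_add_one_cpow (by simpa using hs), ← tsum_mul_left, ← h.tsum_eq]
    refine tsum_congr fun n => ?_
    push_cast
    ring
  have hm : mellin (fun t : ℝ => (((exp t - 1)⁻¹ : ℝ) : ℂ)) s =
      ((∫ x in Ioi 0, x ^ (s - 1) * (exp x - 1)⁻¹ : ℝ) : ℂ) := by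
    rw [mellin, ← integral_complex_ofReal]
    refine setIntegral_congr_fun measurableSet_Ioi fun x hx => ?_
    have hx' : (0 : ℝ) ≤ x := le_of_lt hx
    simp only [smul_eq_mul, Complex.ofReal_mul]
    rw [Complex.ofReal_cpow hx']
    push_cast
    rfl
  rw [hm, Complex.Gamma_ofReal] at hz
  have := congrArg Complex.re hz
  rwa [Complex.ofReal_re, Complex.re_ofReal_mul] at this

theorem integral_boseKernel_pow {k : ℕ} (hk : 1 ≤ k) :
    ∫ y in Ioi (0 : ℝ), boseKernel (y ^ k) =
      (k : ℝ)⁻¹ * (riemannZeta (1 + 1 / (k : ℂ))).re * Gamma (1 + 1 / (k : ℝ)) := by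
  have hk0 : (0 : ℝ) < k := by exact_mod_cast hk
  have hs : (1 : ℝ) < 1 + 1 / k := by
    have : (0 : ℝ) < 1 / k := by positivity
    linarith
  have h := integral_rpow_mul_inv_exp_sub_one hs
  rw [← integral_comp_rpow_Ioi_of_pos hk0] at h
  have e : ∀ y ∈ Ioi (0 : ℝ), ((k : ℝ) * y ^ ((k : ℝ) - 1)) •
      ((y ^ (k : ℝ)) ^ (1 + 1 / (k : ℝ) - 1) * (exp (y ^ (k : ℝ)) - 1)⁻¹) =
      k * boseKernel (y ^ k) := fun y hy => by
    have hy' : (0 : ℝ) < y := hy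
    have e1 : (y ^ (k : ℝ)) ^ (1 + 1 / (k : ℝ) - 1) = y := by
      rw [← rpow_mul hy'.le]
      convert rpow_one y using 2
      field_simp
      ring
    rw [e1, boseKernel_of_ne_zero (pow_pos hy' k).ne', rpow_sub_one hy'.ne', rpow_natCast,
      smul_eq_mul]
    field_simp
  rw [setIntegral_congr_fun measurableSet_Ioi e, integral_const_mul] at h
  have hc : ((1 + 1 / (k : ℝ) : ℝ) : ℂ) = 1 + 1 / (k : ℂ) := by push_cast; rfl
  rw [hc] at h
  rw [mul_assoc, mul_comm (riemannZeta _).re, ← h]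
  field_simp

theorem pow_mul_inv_exp_sub_one_eq {k : ℕ} (hk : 1 ≤ k) {σ : ℝ} (hσ : 0 < σ) (m : ℕ) :
    ((m + 1 : ℕ) : ℝ) ^ k * (exp (((m + 1 : ℕ) : ℝ) ^ k * σ) - 1)⁻¹ =
      σ⁻¹ * boseKernel ((σ ^ (1 / (k : ℝ)) * (m + 1)) ^ k) := by
  have ht : (σ ^ (1 / (k : ℝ))) ^ k = σ := by
    rw [one_div]
    exact rpow_inv_natCast_pow hσ.le (by omega)
  rw [mul_pow, ht, boseKernel_of_ne_zero (by positivity)]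
  push_cast
  rw [mul_comm σ]
  field_simp

theorem iteratedDeriv_boseKernel_mul_pow (k n : ℕ) (t : ℝ) :
    iteratedDeriv n (fun y => boseKernel ((t * y) ^ k)) =
      fun y => t ^ n * iteratedDeriv n (fun y => boseKernel (y ^ k)) (t * y) :=
  iteratedDeriv_comp_const_mul ((contDiff_boseKernel_pow k).of_le (by exact_mod_cast le_top)) t

theorem isBigO_iteratedDeriv_boseKernel_mul_pow {k : ℕ} (hk : 1 ≤ k) (n : ℕ) {t : ℝ}
    (ht : 0 < t) :
    iteratedDeriv n (fun y => boseKernel ((t * y) ^ k)) =O[atTop]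
      fun y => exp (-(t / 2) * y) := by
  rw [iteratedDeriv_boseKernel_mul_pow]
  refine (((isBigO_iteratedDeriv_boseKernel_pow hk n).comp_tendsto
    (tendsto_id.const_mul_atTop ht)).const_mul_left (t ^ n)).congr_right fun y => ?_
  simp only [Function.comp, id]
  congr 1
  ring

theorem summable_pow_mul_inv_exp_sub_one {k : ℕ} (hk : 1 ≤ k) {σ : ℝ} (hσ : 0 < σ) :
    Summable fun m : ℕ => ((m + 1 : ℕ) : ℝ) ^ k * (exp (((m + 1 : ℕ) : ℝ) ^ k * σ) - 1)⁻¹ := by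
  have ht : 0 < σ ^ (1 / (k : ℝ)) := rpow_pos_of_pos hσ _
  have h := isBigO_iteratedDeriv_boseKernel_mul_pow hk 0 ht
  rw [iteratedDeriv_zero] at h
  simp_rw [pow_mul_inv_exp_sub_one_eq hk hσ]
  exact (summable_comp_natCast_add_one_of_isBigO_exp_neg (half_pos ht) h).mul_left σ⁻¹

theorem hasDerivAt_Phi {k : ℕ} (hk : 1 ≤ k) {σ : ℝ} (hσ : 0 < σ) :
    HasDerivAt (Phi k)
      (∑' m : ℕ, -(((m + 1 : ℕ) : ℝ) ^ k * (exp (((m + 1 : ℕ) : ℝ) ^ k * σ) - 1)⁻¹)) σ := by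
  have hpos : ∀ (m : ℕ) {y : ℝ}, 0 < y → 0 < exp (((m + 1 : ℕ) : ℝ) ^ k * y) - 1 := fun m y hy =>
    sub_pos.mpr (one_lt_exp_iff.mpr (by positivity))
  have hpos' : ∀ (m : ℕ) {y : ℝ}, 0 < y → 0 < 1 - exp (-((m + 1 : ℕ) : ℝ) ^ k * y) :=
    fun m y hy => sub_pos.mpr (exp_lt_one_iff.mpr (by rw [neg_mul, neg_lt_zero]; positivity))
  refine hasDerivAt_tsum_of_isPreconnected (t := Ioi (σ / 2)) (y₀ := σ)
    (g := fun (m : ℕ) y => -log (1 - exp (-((m + 1 : ℕ) : ℝ) ^ k * y)))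
    (g' := fun (m : ℕ) y => -(((m + 1 : ℕ) : ℝ) ^ k * (exp (((m + 1 : ℕ) : ℝ) ^ k * y) - 1)⁻¹))
    (summable_pow_mul_inv_exp_sub_one hk (half_pos hσ)) isOpen_Ioi isPreconnected_Ioi
    (fun m y hy => ?_) (fun m y hy => ?_) (half_lt_self hσ) ?_ (half_lt_self hσ)
  · have hy' : 0 < y := (half_pos hσ).trans hy
    have h1 := (hpos' m hy').ne'
    have h2 := (hpos m hy').ne'
    convert! (((((hasDerivAt_id y).const_mul (-((m + 1 : ℕ) : ℝ) ^ k)).exp).const_sub 1).log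
      h1).neg using 1
    simp only [id, mul_one, neg_mul, exp_neg] at h1 ⊢
    field_simp
  · have hy' : 0 < y := (half_pos hσ).trans hy
    have hy2 : σ / 2 ≤ y := le_of_lt hy
    have h3 := hpos m (half_pos hσ)
    rw [norm_neg, norm_of_nonneg (mul_nonneg (by positivity) (inv_nonneg.mpr (hpos m hy').le))]
    gcongr
  · refine (summable_pow_mul_inv_exp_sub_one hk hσ).of_nonneg_of_le (fun m => ?_) (fun m => ?_)
    · exact neg_nonneg.mpr (log_nonpos (hpos' m hσ).le (by linarith [exp_pos (-((m + 1 : ℕ) : ℝ) ^ k * σ)]))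
    · have h1 := hpos' m hσ
      have h2 := hpos m hσ
      have h3 := one_sub_inv_le_log_of_pos h1
      have h4 : (1 - exp (-((m + 1 : ℕ) : ℝ) ^ k * σ))⁻¹ - 1 =
          1 * (exp (((m + 1 : ℕ) : ℝ) ^ k * σ) - 1)⁻¹ := by
        simp only [neg_mul, exp_neg] at h1 ⊢
        field_simp [h1.ne', h2.ne']
        ring
      have h5 : 1 * (exp (((m + 1 : ℕ) : ℝ) ^ k * σ) - 1)⁻¹ ≤
          ((m + 1 : ℕ) : ℝ) ^ k * (exp (((m + 1 : ℕ) : ℝ) ^ k * σ) - 1)⁻¹ :=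
        mul_le_mul_of_nonneg_right (one_le_pow₀ (by simp)) (inv_nonneg.mpr h2.le)
      linarith

theorem sum_bernoulli_mul_iteratedDeriv_boseKernel {k : ℕ} (hk : 1 ≤ k) {σ t : ℝ}
    (ht : t ^ k = σ) :
    ∑ n ∈ Finset.range (2 * k), (-1) ^ (n + 1) * (bernoulliFun (n + 2) 0 / (n + 2)!) *
      iteratedDeriv (n + 1) (fun y => boseKernel ((t * y) ^ k)) 0 =
      -(σ * (riemannZeta (-(k : ℂ))).re / 2) := by
  obtain ⟨j, rfl⟩ : ∃ j, k = j + 1 := ⟨k - 1, by omega⟩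
  rw [Finset.sum_eq_single_of_mem j (by simp; omega)]
  · rw [iteratedDeriv_boseKernel_mul_pow]
    beta_reduce
    rw [mul_zero,
      iteratedDeriv_boseKernel_pow_zero (by omega) (by omega), if_pos rfl, ht,
      riemannZeta_neg_nat_eq_bernoulli, bernoulliFun_eval_zero]
    have e : (-1 : ℂ) ^ (j + 1) * (bernoulli (j + 1 + 1) : ℂ) / ((j + 1 : ℕ) + 1 : ℂ) =
        (((-1) ^ (j + 1) * (bernoulli (j + 1 + 1) : ℝ) / ((j + 1 : ℕ) + 1) : ℝ) : ℂ) := by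
      push_cast
      rfl
    rw [e, Complex.ofReal_re, Nat.factorial_succ (j + 1)]
    have := Nat.factorial_ne_zero (j + 1)
    push_cast
    field_simp
  · intro n hn hnj
    simp only [Finset.mem_range] at hn
    rcases eq_or_ne (n + 1) (2 * (j + 1)) with h | h
    · have h0 : bernoulliFun (n + 2) 0 = 0 := by
        rw [bernoulliFun_eval_zero, bernoulli_eq_zero_of_odd ⟨j + 1, by omega⟩ (by omega),
          Rat.cast_zero]
      rw [h0]
      simp
    · rw [iteratedDeriv_boseKernel_mul_pow]
      beta_reduce
      rw [mul_zero,
        iteratedDeriv_boseKernel_pow_zero (by omega) (by omega), if_neg (by omega)]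
      simp

theorem ak_rpow {k : ℕ} (hk : 1 ≤ k) :
    ak k ^ (1 + 1 / (k : ℝ)) = ∫ y in Ioi (0 : ℝ), boseKernel (y ^ k) := by
  have hk0 : (0 : ℝ) < k := by exact_mod_cast hk
  have h0 : 0 ≤ ∫ y in Ioi (0 : ℝ), boseKernel (y ^ k) :=
    setIntegral_nonneg measurableSet_Ioi fun y hy => by
      have hy' : (0 : ℝ) < y := hy
      rw [boseKernel_of_ne_zero (pow_pos hy' k).ne']
      exact mul_nonneg (by positivity) (inv_nonneg.mpr (exp_pow_sub_one_pos k hy').le)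
  rw [integral_boseKernel_pow hk] at h0 ⊢
  rw [ak, ← rpow_mul h0]
  convert rpow_one _ using 2
  field_simp

/-- The expansion of `-Φ_k'`, with an error bound that is uniform in `σ > 0`. -/
theorem exists_deriv_Phi_bound {k : ℕ} (hk : 1 ≤ k) :
    ∃ C : ℝ, 0 < C ∧ ∀ σ : ℝ, 0 < σ →
      |-deriv (Phi k) σ - (ak k ^ (1 + 1 / (k : ℝ)) / σ ^ (1 + 1 / (k : ℝ))
          - 1 / (2 * σ) - (riemannZeta (-(k : ℂ))).re / 2)| ≤ C * σ := by
  obtain ⟨C, hC⟩ := exists_euler_maclaurin_bound (2 * k)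
  set K := ∫ y in Ioi 0, |iteratedDeriv (2 * k + 1) (fun y => boseKernel (y ^ k)) y|
  refine ⟨|C * K| + 1, by positivity, fun σ hσ => ?_⟩
  set t := σ ^ (1 / (k : ℝ)) with ht_def
  have ht : 0 < t := rpow_pos_of_pos hσ _
  have htk : t ^ k = σ := by
    rw [ht_def, one_div]
    exact rpow_inv_natCast_pow hσ.le (by omega)
  have hcd : ContDiff ℝ ∞ fun y => boseKernel ((t * y) ^ k) :=
    (contDiff_boseKernel_pow k).comp (contDiff_const.mul contDiff_id)
  have h := hC _ _ hcd (half_pos ht)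
    (fun n => isBigO_iteratedDeriv_boseKernel_mul_pow hk n ht)
  rw [sum_bernoulli_mul_iteratedDeriv_boseKernel hk htk,
    iteratedDeriv_boseKernel_mul_pow k (2 * k + 1) t] at h
  simp only [abs_mul, integral_const_mul] at h
  rw [integral_comp_mul_left_Ioi (fun y => boseKernel (y ^ k)) 0 ht,
    integral_comp_mul_left_Ioi
      (fun y => |iteratedDeriv (2 * k + 1) (fun y => boseKernel (y ^ k)) y|) 0 ht,
    mul_zero, zero_pow (by omega), boseKernel_zero, ← ak_rpow hk, abs_of_pos
      (pow_pos ht _)] at h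
  have hrem : C * (t ^ (2 * k + 1) * (t⁻¹ • K)) = C * K * σ ^ 2 := by
    rw [← htk, smul_eq_mul]
    field_simp
    ring
  have hsum : -deriv (Phi k) σ = σ⁻¹ * ∑' m : ℕ, boseKernel ((t * (m + 1)) ^ k) := by
    rw [(hasDerivAt_Phi hk hσ).deriv, tsum_neg, neg_neg, ← tsum_mul_left]
    exact tsum_congr (pow_mul_inv_exp_sub_one_eq hk hσ)
  have hpow : σ ^ (1 + 1 / (k : ℝ)) = σ * t := by
    rw [rpow_add hσ, rpow_one]
  rw [hrem] at h
  rw [hsum, hpow]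
  calc _ = |σ⁻¹ * (∑' m : ℕ, boseKernel ((t * (m + 1)) ^ k)
        - t⁻¹ • ak k ^ (1 + 1 / (k : ℝ)) + 1 / 2
        - -(σ * (riemannZeta (-(k : ℂ))).re / 2))| := by
        congr 1
        rw [smul_eq_mul]
        field_simp
        ring
    _ ≤ σ⁻¹ * (C * K * σ ^ 2) := by
        rw [abs_mul, abs_of_pos (inv_pos.mpr hσ)]
        exact mul_le_mul_of_nonneg_left h (inv_pos.mpr hσ).le
    _ = C * K * σ := by field_simp
    _ ≤ (|C * K| + 1) * σ := by
        gcongr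
        linarith [le_abs_self (C * K)]

end

theorem saddle_point_equation_asymptotic (k : ℕ) (hk : 1 ≤ k) (σ : ℕ → ℝ)
    (hσ : ∀ n : ℕ, 1 ≤ n → 0 < σ n ∧ -deriv (Phi k) (σ n) = n) :
    ∃ C : ℝ, 0 < C ∧ ∃ N : ℕ, ∀ n : ℕ, N ≤ n →
      |(n : ℝ) - (ak k ^ (1 + 1 / (k : ℝ)) / (σ n) ^ (1 + 1 / (k : ℝ))
          - 1 / (2 * σ n) - (riemannZeta (-(k : ℂ))).re / 2)| ≤ C * σ n := by
  obtain ⟨C, hC, h⟩ := exists_deriv_Phi_bound hk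
  refine ⟨C, hC, 1, fun n hn => ?_⟩
  obtain ⟨hpos, hn'⟩ := hσ n hn
  rw [← hn']
  exact h (σ n) hpos
end
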